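/- Let K be a field of characteristic different from 2, and let T = K[x_1, x_2, x_3, x_4]/(x_i x_j : i ≠ j) be the quotient of the polynomial ring by the ideal generated by all products of two distinct variables. Let g = x_1 + x_2 + x_4 and h = x_1 + x_3 + 2x_4 in T. Then g·h^2 does not belong to the ideal of T generated by g^3, g^2·h and h^3. -/

import Mathlib

open MvPolynomial

/-- Restriction of polynomials in four variables to the `i`-th coordinate axis. -/
noncomputable def axisRestrict (K : Type*) [Field K] (i : Fin 4) :
    MvPolynomial (Fin 4) K →ₐ[K] Polynomial K :=
  aeval (Pi.single i Polynomial.X)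

theorem axisRestrict_X (K : Type*) [Field K] (i j : Fin 4) :
    axisRestrict K i (X j) = if j = i then Polynomial.X else 0 := by
  simp [axisRestrict, Pi.single_apply]

theorem axisRestrict_eq_zero {K : Type*} [Field K] (i : Fin 4) {p : MvPolynomial (Fin 4) K}
    (hp : p ∈ Ideal.span {p : MvPolynomial (Fin 4) K | ∃ i j, i ≠ j ∧ p = X i * X j}) :
    axisRestrict K i p = 0 := by
  rw [← RingHom.mem_ker]
  refine Ideal.span_le.2 ?_ hp
  rintro _ ⟨a, b, hab, rfl⟩
  simp only [SetLike.mem_coe, RingHom.mem_ker, map_mul, axisRestrict_X]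
  grind

theorem coeff_zero_axisRestrict {K : Type*} [Field K] (i : Fin 4) (p : MvPolynomial (Fin 4) K) :
    (axisRestrict K i p).coeff 0 = constantCoeff p := by
  induction p using MvPolynomial.induction_on with
  | C a => simp [axisRestrict]
  | add p q hp hq => simp [hp, hq]
  | mul_X p j hp =>
    rw [map_mul, axisRestrict_X, Polynomial.mul_coeff_zero]
    split_ifs <;> simp

/-- A relation in degree three on the four axes restricts to the `i`-th axis as a relation
between the constant coefficients. -/
theorem constantCoeff_relation {K : Type*} [Field K] (i : Fin 4)
    {g h u v w : MvPolynomial (Fin 4) K} {a b : K}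
    (hg : axisRestrict K i g = Polynomial.C a * Polynomial.X)
    (hh : axisRestrict K i h = Polynomial.C b * Polynomial.X)
    (H : g * h ^ 2 - (u * g ^ 3 + (v * (g ^ 2 * h) + w * h ^ 3)) ∈
      Ideal.span {p : MvPolynomial (Fin 4) K | ∃ i j, i ≠ j ∧ p = X i * X j}) :
    a * b ^ 2 = constantCoeff u * a ^ 3 + constantCoeff v * (a ^ 2 * b) +
      constantCoeff w * b ^ 3 := by
  have e := axisRestrict_eq_zero i H
  simp only [map_sub, map_add, map_mul, map_pow, hg, hh] at e
  have e' : (Polynomial.C (a * b ^ 2) - (axisRestrict K i u * Polynomial.C (a ^ 3) +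
      axisRestrict K i v * Polynomial.C (a ^ 2 * b) +
      axisRestrict K i w * Polynomial.C (b ^ 3))) * Polynomial.X ^ 3 = 0 := by
    rw [← e]
    simp only [map_mul, map_pow]
    ring
  have e0 := congrArg (Polynomial.coeff · 0)
    ((mul_eq_zero.1 e').resolve_right (pow_ne_zero 3 Polynomial.X_ne_zero))
  simp only [Polynomial.coeff_sub, Polynomial.coeff_add, Polynomial.mul_coeff_zero,
    Polynomial.coeff_C_zero, coeff_zero_axisRestrict, Polynomial.coeff_zero] at e0
  linear_combination e0

/-- Let `K` be a field of characteristic `≠ 2` and `T = K[x_1,x_2,x_3,x_4]/(x_i x_j : i ≠ j)`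
the ring of four axes. With `g = x_1 + x_2 + x_4` and `h = x_1 + x_3 + 2 x_4` in `T`, the
element `g h²` does not belong to the ideal `(g³, g² h, h³)` of `T`. -/
theorem stmt_18 (K : Type*) [Field K] (h2 : (2 : K) ≠ 0) :
    ¬ (Ideal.Quotient.mk
        (Ideal.span {p : MvPolynomial (Fin 4) K | ∃ i j, i ≠ j ∧ p = X i * X j})
        (X 0 + X 1 + X 3) *
      Ideal.Quotient.mk
        (Ideal.span {p : MvPolynomial (Fin 4) K | ∃ i j, i ≠ j ∧ p = X i * X j})
        (X 0 + X 2 + 2 * X 3) ^ 2 ∈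
      Ideal.span
        {Ideal.Quotient.mk
            (Ideal.span {p : MvPolynomial (Fin 4) K | ∃ i j, i ≠ j ∧ p = X i * X j})
            (X 0 + X 1 + X 3) ^ 3,
         Ideal.Quotient.mk
            (Ideal.span {p : MvPolynomial (Fin 4) K | ∃ i j, i ≠ j ∧ p = X i * X j})
            (X 0 + X 1 + X 3) ^ 2 *
          Ideal.Quotient.mk
            (Ideal.span {p : MvPolynomial (Fin 4) K | ∃ i j, i ≠ j ∧ p = X i * X j})
            (X 0 + X 2 + 2 * X 3),
         Ideal.Quotient.mk
            (Ideal.span {p : MvPolynomial (Fin 4) K | ∃ i j, i ≠ j ∧ p = X i * X j})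
            (X 0 + X 2 + 2 * X 3) ^ 3}) := by
  intro hmem
  obtain ⟨u, z, hz, e⟩ := Ideal.mem_span_insert.1 hmem
  obtain ⟨v, w, rfl⟩ := Ideal.mem_span_pair.1 hz
  obtain ⟨u, rfl⟩ := Ideal.Quotient.mk_surjective u
  obtain ⟨v, rfl⟩ := Ideal.Quotient.mk_surjective v
  obtain ⟨w, rfl⟩ := Ideal.Quotient.mk_surjective w
  simp only [← map_pow, ← map_mul, ← map_add] at e
  have H := Ideal.Quotient.eq.1 e
  have r0 := constantCoeff_relation 0 (a := 1) (b := 1)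
    (by simp [axisRestrict_X]) (by simp [axisRestrict_X]) H
  have r1 := constantCoeff_relation 1 (a := 1) (b := 0)
    (by simp [axisRestrict_X]) (by simp [axisRestrict_X]) H
  have r2 := constantCoeff_relation 2 (a := 0) (b := 1)
    (by simp [axisRestrict_X]) (by simp [axisRestrict_X]) H
  have r3 := constantCoeff_relation 3 (a := 1) (b := 2)
    (by simp [axisRestrict_X])
    (by simpa [axisRestrict_X] using (map_ofNat _ 2).trans (map_ofNat Polynomial.C 2).symm) H
  exact h2 (by linear_combination r3 - 2 * r0 + r1 - 6 * r2)
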